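/- (Theorem 1(i)) Let e be an empirical model on a measurement scenario (X, M, O) and let (a, R) be a Bell inequality with R < ‖a‖. Then the normalized violation of (a, R) by e is at most the contextual fraction: max{0, a·e − R} / (‖a‖ − R) ≤ CF(e). -/

import Mathlib

open Finset

/-- Assignments of outcomes in `O` to the measurements in a context `C`. -/
abbrev Assign {X : Type} (C : Finset X) (O : Type) : Type := {x // x ∈ C} → O

variable {X O : Type} [Fintype X] [DecidableEq X] [Fintype O] [DecidableEq O]

/-- Marginalisation of a distribution on assignments on `C` to a subset `U ⊆ C`. -/
noncomputable def marg {C U : Finset X} (h : U ⊆ C) (d : Assign C O → ℝ) :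
    Assign U O → ℝ :=
  fun t => ∑ s ∈ univ.filter
    (fun s : Assign C O => ∀ u : {x // x ∈ U}, s ⟨u.1, h u.2⟩ = t u), d s

/-- Marginalisation of a distribution on global assignments to a context `C`. -/
noncomputable def margG (C : Finset X) (d : (X → O) → ℝ) : Assign C O → ℝ :=
  fun t => ∑ g ∈ univ.filter (fun g : X → O => ∀ x : {x // x ∈ C}, g x.1 = t x), d g

/-- `d` is a probability distribution on the finite type `α`. -/
def IsProb {α : Type} [Fintype α] (d : α → ℝ) : Prop :=
  (∀ a, 0 ≤ d a) ∧ ∑ a, d a = 1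

/-- An empirical model on the scenario `(X, M, O)`: a probability distribution on each
context of `M`, compatible on overlaps. -/
def IsEmpiricalModel (M : Finset (Finset X)) (e : ∀ C : Finset X, Assign C O → ℝ) : Prop :=
  (∀ C ∈ M, IsProb (e C)) ∧
  ∀ C ∈ M, ∀ C' ∈ M,
    marg (inter_subset_left : C ∩ C' ⊆ C) (e C) =
    marg (inter_subset_right : C ∩ C' ⊆ C') (e C')

/-- A model is non-contextual if it is the marginalisation of a probability
distribution on global assignments. -/
def NonContextual (M : Finset (Finset X)) (e : ∀ C : Finset X, Assign C O → ℝ) : Prop :=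
  ∃ d : (X → O) → ℝ, IsProb d ∧ ∀ C ∈ M, margG C d = e C

/-- A model is strongly contextual if no global assignment is consistent with its support. -/
def StronglyContextual (M : Finset (Finset X)) (e : ∀ C : Finset X, Assign C O → ℝ) : Prop :=
  ¬ ∃ g : X → O, ∀ C ∈ M, 0 < e C (fun x => g x.1)

/-- `b` is a subprobability distribution on global assignments whose marginals are
  dominated by the empirical model `e`. -/
def Feasible (M : Finset (Finset X)) (e : ∀ C : Finset X, Assign C O → ℝ)
    (b : (X → O) → ℝ) : Prop :=
  (∀ g, 0 ≤ b g) ∧ (∑ g, b g) ≤ 1 ∧ ∀ C ∈ M, ∀ t, margG C b t ≤ e C t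

/-- The non-contextual fraction: the maximum weight of a subprobability distribution on
global assignments dominated by `e`. -/
noncomputable def NCF (M : Finset (Finset X)) (e : ∀ C : Finset X, Assign C O → ℝ) : ℝ :=
  sSup {w | ∃ b : (X → O) → ℝ, Feasible M e b ∧ ∑ g, b g = w}

/-- The contextual fraction. -/
noncomputable def CF (M : Finset (Finset X)) (e : ∀ C : Finset X, Assign C O → ℝ) : ℝ :=
  1 - NCF M e

/-- The pairing `a·e` between inequality coefficients and an empirical model. -/
def dotM {X O : Type} [Fintype X] [DecidableEq X] [Fintype O] [DecidableEq O]
    (M : Finset (Finset X)) (a e : ∀ C : Finset X, Assign C O → ℝ) : ℝ :=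
  ∑ C ∈ M, ∑ s, a C s * e C s

/-- The algebraic bound `‖a‖ = Σ_C max_s a[C,s]` of a system of coefficients. -/
noncomputable def normM {X O : Type} [Fintype X] [DecidableEq X] [Fintype O] [DecidableEq O]
    [Nonempty O] (M : Finset (Finset X)) (a : ∀ C : Finset X, Assign C O → ℝ) : ℝ :=
  ∑ C ∈ M, (univ : Finset (Assign C O)).sup' univ_nonempty (a C)

/-- Pairing with a marginal is integration of the restricted function. -/
theorem sum_mul_margG {X O : Type} [Fintype X] [DecidableEq X] [Fintype O] [DecidableEq O]
    (C : Finset X) (f : Assign C O → ℝ) (d : (X → O) → ℝ) :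
    ∑ s, f s * margG C d s = ∑ g, d g * f (fun x => g x.1) := by
  have h : ∀ (s : Assign C O) (g : X → O),
      (∀ x : {x // x ∈ C}, g x.1 = s x) ↔ (fun x : {x // x ∈ C} => g x.1) = s :=
    fun s g => funext_iff.symm
  simp only [margG, h, sum_filter, mul_sum]
  rw [sum_comm]
  simp [mul_comm]

theorem sum_margG {X O : Type} [Fintype X] [DecidableEq X] [Fintype O] [DecidableEq O]
    (C : Finset X) (d : (X → O) → ℝ) : ∑ s, margG C d s = ∑ g, d g := by
  simpa using sum_mul_margG C (fun _ => 1) d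

theorem marg_margG {X O : Type} [Fintype X] [DecidableEq X] [Fintype O] [DecidableEq O]
    {C U : Finset X} (h : U ⊆ C) (d : (X → O) → ℝ) :
    marg h (margG C d) = margG U d := by
  funext t
  have key := sum_mul_margG C
    (fun s => if ∀ u : {x // x ∈ U}, s ⟨u.1, h u.2⟩ = t u then 1 else 0) d
  simp only [ite_mul, one_mul, zero_mul, mul_ite, mul_one, mul_zero] at key
  simpa only [marg, margG, sum_filter] using key

theorem isEmpiricalModel_margG {X O : Type} [Fintype X] [DecidableEq X] [Fintype O]
    [DecidableEq O] (M : Finset (Finset X)) {d : (X → O) → ℝ} (hd : IsProb d) :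
    IsEmpiricalModel M (fun C => margG C d) := by
  refine ⟨fun C _ => ⟨fun t => sum_nonneg fun g _ => hd.1 g, ?_⟩, fun C _ C' _ => ?_⟩
  · rw [sum_margG, hd.2]
  · rw [marg_margG, marg_margG]

theorem dotM_margG {X O : Type} [Fintype X] [DecidableEq X] [Fintype O] [DecidableEq O]
    (M : Finset (Finset X)) (a : ∀ C : Finset X, Assign C O → ℝ) (d : (X → O) → ℝ) :
    dotM M a (fun C => margG C d) = ∑ g, d g * ∑ C ∈ M, a C (fun x => g x.1) := by
  simp only [dotM, sum_mul_margG, mul_sum]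
  exact sum_comm

/-- A Bell inequality bounds the value of every deterministic global assignment. -/
theorem sum_restrict_le_of_bell {X O : Type} [Fintype X] [DecidableEq X] [Fintype O]
    [DecidableEq O] (M : Finset (Finset X)) (a : ∀ C : Finset X, Assign C O → ℝ) (R : ℝ)
    (hBell : ∀ e' : ∀ C : Finset X, Assign C O → ℝ,
      IsEmpiricalModel M e' → NonContextual M e' → dotM M a e' ≤ R) (g : X → O) :
    ∑ C ∈ M, a C (fun x => g x.1) ≤ R := by
  have hd : IsProb (fun g' : X → O => if g' = g then (1 : ℝ) else 0) :=
    ⟨fun g' => by dsimp only; split_ifs <;> norm_num, by simp⟩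
  have h := hBell _ (isEmpiricalModel_margG M hd) ⟨_, hd, fun _ _ => rfl⟩
  rw [dotM_margG] at h
  simpa using h

/-- A feasible subdistribution of weight `w` forces `a·e ≤ w R + (1 - w) ‖a‖`. -/
theorem dotM_le_of_feasible {X O : Type} [Fintype X] [DecidableEq X] [Fintype O]
    [DecidableEq O] [Nonempty O] (M : Finset (Finset X)) (e : ∀ C : Finset X, Assign C O → ℝ)
    (he : IsEmpiricalModel M e) (a : ∀ C : Finset X, Assign C O → ℝ) (R : ℝ)
    (hBell : ∀ e' : ∀ C : Finset X, Assign C O → ℝ,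
      IsEmpiricalModel M e' → NonContextual M e' → dotM M a e' ≤ R)
    {b : (X → O) → ℝ} (hb : Feasible M e b) :
    dotM M a e ≤ (∑ g, b g) * R + (1 - ∑ g, b g) * normM M a := by
  have hcontext : dotM M a (fun C => margG C b) ≤ (∑ g, b g) * R := by
    rw [dotM_margG, sum_mul]
    exact sum_le_sum fun g _ =>
      mul_le_mul_of_nonneg_left (sum_restrict_le_of_bell M a R hBell g) (hb.1 g)
  have hrest : dotM M a e - dotM M a (fun C => margG C b) ≤
      (1 - ∑ g, b g) * normM M a := by
    simp only [dotM, normM, mul_sum, ← sum_sub_distrib, ← mul_sub]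
    refine sum_le_sum fun C hC => ?_
    calc ∑ s, a C s * (e C s - margG C b s)
        ≤ ∑ s, univ.sup' univ_nonempty (a C) * (e C s - margG C b s) :=
          sum_le_sum fun s _ => mul_le_mul_of_nonneg_right (le_sup' (a C) (mem_univ s))
            (sub_nonneg.2 (hb.2.2 C hC s))
      _ = (1 - ∑ g, b g) * univ.sup' univ_nonempty (a C) := by
          rw [← mul_sum, sum_sub_distrib, (he.1 C hC).2, sum_margG, mul_comm]
  linarith

/-- **Theorem 1(i).** The normalised violation by `e` of any Bell
inequality `(a, R)` with `R < ‖a‖` is at most the contextual fraction `CF(e)`. -/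
theorem normalised_violation_le_contextual_fraction
    {X O : Type} [Fintype X] [DecidableEq X] [Fintype O] [DecidableEq O] [Nonempty O]
    (M : Finset (Finset X)) (e : ∀ C : Finset X, Assign C O → ℝ)
    (he : IsEmpiricalModel M e)
    (a : ∀ C : Finset X, Assign C O → ℝ) (R : ℝ) (hR : 0 ≤ R)
    (hBell : ∀ e' : ∀ C : Finset X, Assign C O → ℝ,
      IsEmpiricalModel M e' → NonContextual M e' → dotM M a e' ≤ R)
    (hlt : R < normM M a) :
    max 0 (dotM M a e - R) / (normM M a - R) ≤ CF M e := by
  have hpos : 0 < normM M a - R := sub_pos.2 hlt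
  rw [CF, le_sub_comm, NCF]
  refine csSup_le ⟨0, fun _ => 0, ⟨fun _ => le_rfl, by simp, fun C hC t => ?_⟩, by simp⟩ ?_
  · simpa [margG] using (he.1 C hC).1 t
  · rintro w ⟨b, hb, rfl⟩
    rw [le_sub_comm, div_le_iff₀ hpos]
    refine max_le (mul_nonneg (sub_nonneg.2 hb.2.1) hpos.le) ?_
    linarith [dotM_le_of_feasible M e he a R hBell hb]
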